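/- Fix α ∈ (0, 1/2). For all real numbers σ, σ′ with 0 < σ < σ′, all μ ≥ 0, and all Ψ > 0, it holds that H(σ, μ, Ψ) < H(σ′, μ, Ψ), where H(σ, μ, Ψ) = Φ((Ψ + μ)/σ + G(μ/σ)) − Φ(Ψ/σ − G(μ/σ)). -/

import Mathlib

open MeasureTheory ProbabilityTheory

/-- The standard normal cumulative distribution function. -/
noncomputable def Phi (x : ℝ) : ℝ := (gaussianReal 0 1 (Set.Iic x)).toReal

/-- `H(σ, μ, Ψ) = Φ((Ψ + μ)/σ + G(μ/σ)) − Φ(Ψ/σ − G(μ/σ))`, for a given `G`. -/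
noncomputable def Hfun (G : ℝ → ℝ) (σ μ Ψ : ℝ) : ℝ :=
  Phi ((Ψ + μ) / σ + G (μ / σ)) - Phi (Ψ / σ - G (μ / σ))

lemma continuous_gaussianPDFReal_std : Continuous (gaussianPDFReal 0 1) := by
  unfold gaussianPDFReal
  fun_prop

lemma Phi_sub_Phi_eq_integral (a b : ℝ) :
    Phi b - Phi a = ∫ x in a..b, gaussianPDFReal 0 1 x := by
  have h : ∀ x, Phi x = ∫ t in Set.Iic x, gaussianPDFReal 0 1 t := fun x => by
    rw [Phi, gaussianReal_apply_eq_integral 0 one_ne_zero, ENNReal.toReal_ofReal]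
    exact integral_nonneg fun t => gaussianPDFReal_nonneg 0 1 t
  rw [h, h, intervalIntegral.integral_Iic_sub_Iic] <;>
    exact (integrable_gaussianPDFReal 0 1).integrableOn

lemma Phi_strictMono : StrictMono Phi := fun a b hab => by
  rw [← sub_pos, Phi_sub_Phi_eq_integral]
  exact intervalIntegral.intervalIntegral_pos_of_pos
    (continuous_gaussianPDFReal_std.intervalIntegrable _ _)
    (fun x => gaussianPDFReal_pos 0 1 x one_ne_zero) hab

/-- Translating the standard normal density tilts it exponentially. -/
lemma gaussianPDFReal_std_add (x p : ℝ) :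
    gaussianPDFReal 0 1 (x + p) =
      gaussianPDFReal 0 1 x * Real.exp (-(p * x)) * Real.exp (-(p ^ 2 / 2)) := by
  simp only [gaussianPDFReal, mul_assoc, ← Real.exp_add]
  congr 2
  simp only [NNReal.coe_one]
  ring

lemma gaussianPDFReal_std_lt_of_sq_lt {x y : ℝ} (h : x ^ 2 < y ^ 2) :
    gaussianPDFReal 0 1 y < gaussianPDFReal 0 1 x := by
  simp only [gaussianPDFReal]
  refine mul_lt_mul_of_pos_left (Real.exp_lt_exp.2 ?_) (by positivity)
  simp only [NNReal.coe_one]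
  linarith

/-- An interval reaching at least as far to the right of `0` as to the left loses normal mass
when it is moved to the right. -/
lemma Phi_sub_Phi_strictAnti_shift {b c p q : ℝ} (hc : 0 < c) (hcb : c ≤ b) (hp : 0 < p)
    (hpq : p < q) : Phi (q + b) - Phi (q - c) < Phi (p + b) - Phi (p - c) := by
  suffices h : Phi (q + b) - Phi (p + b) < Phi (q - c) - Phi (p - c) by linarith
  have hshift : Phi (q + b) - Phi (p + b) =
      ∫ x in (p - c)..(q - c), gaussianPDFReal 0 1 (x + (b + c)) := by
    rw [Phi_sub_Phi_eq_integral, intervalIntegral.integral_comp_add_right]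
    congr 1 <;> ring
  have key : ∀ x ∈ Set.Icc (p - c) (q - c),
      gaussianPDFReal 0 1 (x + (b + c)) < gaussianPDFReal 0 1 x := fun x hx =>
    gaussianPDFReal_std_lt_of_sq_lt (by nlinarith [hx.1])
  rw [hshift, Phi_sub_Phi_eq_integral]
  exact intervalIntegral.integral_lt_integral_of_continuousOn_of_le_of_exists_lt (by linarith)
    (continuous_gaussianPDFReal_std.comp (continuous_add_const _)).continuousOn
    continuous_gaussianPDFReal_std.continuousOn
    (fun x hx => (key x (Set.Ioc_subset_Icc_self hx)).le)
    ⟨p - c, Set.left_mem_Icc.2 (by linarith), key _ (Set.left_mem_Icc.2 (by linarith))⟩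

/-- A shift to the right by `p` scales the normal mass of an interval of nonnegative reals by at
most `exp (-p ^ 2 / 2)`. -/
lemma Phi_sub_Phi_shift_le {a b p : ℝ} (ha : 0 ≤ a) (hab : a ≤ b) (hp : 0 ≤ p) :
    Phi (b + p) - Phi (a + p) ≤ (Phi b - Phi a) * Real.exp (-(p ^ 2 / 2)) := by
  rw [Phi_sub_Phi_eq_integral, Phi_sub_Phi_eq_integral, ← intervalIntegral.integral_mul_const,
    ← intervalIntegral.integral_comp_add_right]
  have hc := continuous_gaussianPDFReal_std
  refine intervalIntegral.integral_mono_on hab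
    ((hc.comp (continuous_add_const p)).intervalIntegrable _ _)
    ((hc.mul continuous_const).intervalIntegrable _ _) fun x hx => ?_
  rw [gaussianPDFReal_std_add]
  refine mul_le_mul_of_nonneg_right ?_ (Real.exp_pos _).le
  refine mul_le_of_le_one_right (gaussianPDFReal_nonneg 0 1 x) (Real.exp_le_one_iff.2 ?_)
  exact neg_nonpos.2 (mul_nonneg hp (ha.trans hx.1))

/-- A shift to the right by `p` scales the normal mass of an interval of nonpositive reals by at
least `exp (-p ^ 2 / 2)`. -/
lemma le_Phi_sub_Phi_shift {a b p : ℝ} (hb : b ≤ 0) (hab : a ≤ b) (hp : 0 ≤ p) :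
    (Phi b - Phi a) * Real.exp (-(p ^ 2 / 2)) ≤ Phi (b + p) - Phi (a + p) := by
  rw [Phi_sub_Phi_eq_integral, Phi_sub_Phi_eq_integral, ← intervalIntegral.integral_mul_const,
    ← intervalIntegral.integral_comp_add_right]
  have hc := continuous_gaussianPDFReal_std
  refine intervalIntegral.integral_mono_on hab
    ((hc.mul continuous_const).intervalIntegrable _ _)
    ((hc.comp (continuous_add_const p)).intervalIntegrable _ _) fun x hx => ?_
  rw [gaussianPDFReal_std_add]
  refine mul_le_mul_of_nonneg_right ?_ (Real.exp_pos _).le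
  refine le_mul_of_one_le_right (gaussianPDFReal_nonneg 0 1 x) (Real.one_le_exp ?_)
  exact neg_nonneg.2 (mul_nonpos_of_nonneg_of_nonpos hp (hx.2.trans hb))

/-- Of two intervals `[-c, c + y]` and `[-c', c' + y']` of equal normal mass with `y' ≤ y`, the
second has at least the mass of the first after both are moved to the right by `p`. -/
lemma Phi_sub_Phi_shift_le_of_eq {c c' y y' p : ℝ} (hc : 0 < c) (hc' : 0 < c') (hy' : 0 ≤ y')
    (hyy : y' ≤ y) (hp : 0 ≤ p) (h : Phi (c + y) - Phi (-c) = Phi (c' + y') - Phi (-c')) :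
    Phi (p + (c + y)) - Phi (p - c) ≤ Phi (p + (c' + y')) - Phi (p - c') := by
  have hcc : c ≤ c' := by
    by_contra! hlt
    have h₁ := Phi_strictMono (show c' + y' < c + y by linarith)
    have h₂ := Phi_strictMono (neg_lt_neg hlt)
    linarith
  have hbb : c' + y' ≤ c + y := by
    by_contra! hlt
    have h₁ := Phi_strictMono hlt
    have h₂ := Phi_strictMono (show -c' < -c by linarith)
    linarith
  have hright := Phi_sub_Phi_shift_le (by linarith) hbb hp
  have hleft := le_Phi_sub_Phi_shift (neg_nonpos.2 hc.le) (neg_le_neg hcc) hp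
  rw [show Phi (c + y) - Phi (c' + y') = Phi (-c) - Phi (-c') by linarith] at hright
  rw [add_comm p, add_comm p, sub_eq_neg_add p c, sub_eq_neg_add p c']
  linarith

/-- For fixed `α ∈ (0, 1/2)`, with `G` the function assigning to each
`y ≥ 0` the unique `c > 0` with `Φ(c + y) − Φ(−c) = 1 − α`, the function
`H(σ, μ, Ψ) = Φ((Ψ + μ)/σ + G(μ/σ)) − Φ(Ψ/σ − G(μ/σ))` is strictly increasing in `σ`
when `Ψ > 0`: for `0 < σ < σ′`, `μ ≥ 0`, `Ψ > 0`, `H(σ, μ, Ψ) < H(σ′, μ, Ψ)`. -/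
theorem H_strictMono_in_sigma
    (α : ℝ) (hα : 0 < α) (hα' : α < 1 / 2)
    (G : ℝ → ℝ)
    (hG : ∀ y : ℝ, 0 ≤ y → 0 < G y ∧ Phi (G y + y) - Phi (-(G y)) = 1 - α)
    (σ σ' μ Ψ : ℝ) (hσ : 0 < σ) (hσσ' : σ < σ') (hμ : 0 ≤ μ) (hΨ : 0 < Ψ) :
    Hfun G σ μ Ψ < Hfun G σ' μ Ψ := by
  have hσ' : 0 < σ' := hσ.trans hσσ'
  have hy : 0 ≤ μ / σ := div_nonneg hμ hσ.le
  have hy' : 0 ≤ μ / σ' := div_nonneg hμ hσ'.le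
  obtain ⟨hc, he⟩ := hG _ hy
  obtain ⟨hc', he'⟩ := hG _ hy'
  have hH : ∀ s, Hfun G s μ Ψ =
      Phi (Ψ / s + (G (μ / s) + μ / s)) - Phi (Ψ / s - G (μ / s)) := fun s => by
    rw [Hfun, add_div, add_assoc, add_comm (μ / s)]
  rw [hH, hH]
  have hp' : 0 < Ψ / σ' := div_pos hΨ hσ'
  exact (Phi_sub_Phi_strictAnti_shift hc (by linarith) hp'
    (div_lt_div_of_pos_left hΨ hσ hσσ')).trans_le
    (Phi_sub_Phi_shift_le_of_eq hc hc' hy' (div_le_div_of_nonneg_left hμ hσ hσσ'.le)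
      hp'.le (he.trans he'.symm))
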